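/- arXiv:2404.11282 — 2 statements merged into one kernel-verified Lean document; each statement's English description precedes it below -/
import Mathlib

section
/- Let L : ℝⁿ → Mat(n,ℝ) be a Nijenhuis operator with smooth entries, σ₁,…,σ_n the coefficients of its characteristic polynomial, and J(x) the Jacobi matrix of (σ₁,…,σ_n). If at a point x the differentials dσ₁(x),…,dσ_n(x) are linearly independent (so J(x) is invertible), then L(x) = J(x)⁻¹ · S_χ(x) · J(x), where S_χ(x) is the companion-type matrix with first column (−σ₁(x),…,−σ_n(x))ᵀ, ones on the superdiagonal, and zeros elsewhere. -/
open Matrix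

/-- Components `N^i_{jk}` of the Nijenhuis torsion of a matrix-valued operator
field `L` on `ℝⁿ` (with `L x i j = L^i_j(x)`). -/
noncomputable def nijTorsion {n : ℕ} (L : (Fin n → ℝ) → Matrix (Fin n) (Fin n) ℝ)
    (x : Fin n → ℝ) (i j k : Fin n) : ℝ :=
  ∑ s : Fin n,
    (L x s j * fderiv ℝ (fun y => L y i k) x (Pi.single s 1)
      - L x s k * fderiv ℝ (fun y => L y i j) x (Pi.single s 1)
      - L x i s * fderiv ℝ (fun y => L y s k) x (Pi.single j 1)
      + L x i s * fderiv ℝ (fun y => L y s j) x (Pi.single k 1))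

/-- `L` is a Nijenhuis operator: its Nijenhuis torsion vanishes identically. -/
def IsNijenhuis {n : ℕ} (L : (Fin n → ℝ) → Matrix (Fin n) (Fin n) ℝ) : Prop :=
  ∀ x i j k, nijTorsion L x i j k = 0

/-- Bilinear product on `ℝⁿ` with structure constants `a i j k`
(`ηᵢ ⋆ ηⱼ = ∑ₖ a i j k • ηₖ`). -/
def mulSC {n : ℕ} (a : Fin n → Fin n → Fin n → ℝ) (ξ η : Fin n → ℝ) : Fin n → ℝ :=
  fun k => ∑ i : Fin n, ∑ j : Fin n, a i j k * ξ i * η j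

/-- Left-symmetry: the associator is symmetric in its first two arguments. -/
def IsLSA {n : ℕ} (a : Fin n → Fin n → Fin n → ℝ) : Prop :=
  ∀ ξ η ζ : Fin n → ℝ,
    mulSC a (mulSC a ξ η) ζ - mulSC a ξ (mulSC a η ζ)
      = mulSC a (mulSC a η ξ) ζ - mulSC a η (mulSC a ξ ζ)

/-- The right-adjoint operator field of the algebra with structure constants `a`:
`(R x) k i = ∑ j, a i j k * x j`, i.e. `(R x).mulVec ξ = ξ ⋆ x`. -/
def rightAdj {n : ℕ} (a : Fin n → Fin n → Fin n → ℝ) (x : Fin n → ℝ) :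
    Matrix (Fin n) (Fin n) ℝ :=
  Matrix.of fun k i => ∑ j : Fin n, a i j k * x j

/-- `charCoeff L i` is the coefficient `σ_{i+1}` of `t^(n-1-i)` in the characteristic
polynomial `χ_{L(x)}(t) = tⁿ + σ₁(x) tⁿ⁻¹ + ⋯ + σₙ(x)` of `L(x)`. -/
noncomputable def charCoeff {n : ℕ} (L : (Fin n → ℝ) → Matrix (Fin n) (Fin n) ℝ)
    (i : Fin n) : (Fin n → ℝ) → ℝ :=
  fun x => (L x).charpoly.coeff (n - 1 - (i : ℕ))

/-- A (structure-constant) algebra is differentially non-degenerate if the coefficients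
of the characteristic polynomial of its right-adjoint operator are algebraically
independent over `ℝ` (as elements of the algebra of real-valued functions). -/
def DiffNonDeg {n : ℕ} (a : Fin n → Fin n → Fin n → ℝ) : Prop :=
  AlgebraicIndependent ℝ (charCoeff (rightAdj a))

/-- Isomorphism of the algebras on `ℝⁿ` with structure constants `a` and `b`. -/
def AlgIsoSC {n : ℕ} (a b : Fin n → Fin n → Fin n → ℝ) : Prop :=
  ∃ φ : (Fin n → ℝ) ≃ₗ[ℝ] (Fin n → ℝ),
    ∀ ξ η : Fin n → ℝ, φ (mulSC a ξ η) = mulSC b (φ ξ) (φ η)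

/-- Jacobi matrix of a family of functions `σ` on `ℝⁿ`: `J i j = ∂σᵢ/∂xⱼ`. -/
noncomputable def jacobiMat {n : ℕ} (σ : Fin n → (Fin n → ℝ) → ℝ) (x : Fin n → ℝ) :
    Matrix (Fin n) (Fin n) ℝ :=
  Matrix.of fun i j => fderiv ℝ (σ i) x (Pi.single j 1)

/-- Companion-type matrix with first column `(-s 0, …, -s (n-1))ᵀ`, ones on the
superdiagonal and zeros elsewhere. -/
def companionS {n : ℕ} (s : Fin n → ℝ) : Matrix (Fin n) (Fin n) ℝ :=
  Matrix.of fun i j => if (j : ℕ) = 0 then -s i else if (j : ℕ) = (i : ℕ) + 1 then 1 else 0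

theorem Matrix.det_updateRow_eq_sum_adjugate {ι R : Type*} [Fintype ι] [DecidableEq ι]
    [CommRing R] (A : Matrix ι ι R) (i : ι) (b : ι → R) :
    (A.updateRow i b).det = ∑ k, A.adjugate k i * b k := by
  rw [← cramer_transpose_apply, cramer_eq_adjugate_mulVec, ← adjugate_transpose]
  rfl

/-- Jacobi's formula for the derivative of a determinant. -/
theorem HasFDerivAt.matrix_det {ι E : Type*} [Fintype ι] [DecidableEq ι]
    [NormedAddCommGroup E] [NormedSpace ℝ E] {A : E → Matrix ι ι ℝ}
    {A' : ι → ι → E →L[ℝ] ℝ} {x : E}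
    (hA : ∀ i j, HasFDerivAt (fun y => A y i j) (A' i j) x) :
    HasFDerivAt (fun y => (A y).det) (∑ i, ∑ k, (A x).adjugate k i • A' i k) x := by
  let f : ContinuousMultilinearMap ℝ (fun _ : ι => ι → ℝ) ℝ :=
    { (detRowAlternating : (ι → ℝ) [⋀^ι]→ₗ[ℝ] ℝ).toMultilinearMap with
      cont := Continuous.matrix_det continuous_id }
  have h := HasFDerivAt.multilinear_comp f (g := fun i y => A y i)
    (fun i => hasFDerivAt_pi.2 (hA i))
  refine h.congr_fderiv ?_
  ext v
  simp only [_root_.sum_apply, _root_.smul_apply, smul_eq_mul]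
  refine Finset.sum_congr rfl fun i _ => ?_
  exact det_updateRow_eq_sum_adjugate (A x) i fun k => A' i k v

/-- The entrywise directional derivative of a matrix-valued map. -/
noncomputable def entryDeriv {n : ℕ} (L : (Fin n → ℝ) → Matrix (Fin n) (Fin n) ℝ)
    (x v : Fin n → ℝ) : Matrix (Fin n) (Fin n) ℝ :=
  Matrix.of fun i k => fderiv ℝ (fun y => L y i k) x v

/-- Vanishing of the Nijenhuis torsion in matrix form: the derivative of `L` along the `j`-th
column of `L` equals `L * ∂ⱼL` up to a commutator with `L`. -/
theorem IsNijenhuis.exists_sum_entryDeriv {n : ℕ}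
    {L : (Fin n → ℝ) → Matrix (Fin n) (Fin n) ℝ} (hN : IsNijenhuis L) (x : Fin n → ℝ)
    (j : Fin n) :
    ∃ E : Matrix (Fin n) (Fin n) ℝ,
      ∑ s, L x s j • entryDeriv L x (Pi.single s 1)
        = L x * entryDeriv L x (Pi.single j 1) + (E * L x - L x * E) := by
  refine ⟨Matrix.of fun i k => fderiv ℝ (fun y => L y i j) x (Pi.single k 1), ?_⟩
  ext i k
  have h := hN x i j k
  simp only [nijTorsion, Finset.sum_add_distrib, Finset.sum_sub_distrib] at h
  simp only [entryDeriv, Matrix.sum_apply, Matrix.smul_apply, Matrix.add_apply,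
    Matrix.sub_apply, Matrix.mul_apply, Matrix.of_apply, smul_eq_mul]
  simp only [mul_comm _ (L x _ k)]
  linarith

theorem Matrix.trace_mul_commutator_eq_zero {ι R : Type*} [Fintype ι] [CommRing R]
    {B M : Matrix ι ι R} (h : Commute B M) (E : Matrix ι ι R) :
    (B * (E * M - M * E)).trace = 0 := by
  rw [mul_sub, trace_sub, ← Matrix.mul_assoc, ← Matrix.mul_assoc, trace_mul_cycle, h.eq, sub_self]

theorem Matrix.commute_adjugate {ι R : Type*} [Fintype ι] [DecidableEq ι] [CommRing R]
    (M : Matrix ι ι R) : Commute M.adjugate M := by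
  rw [Commute, SemiconjBy, adjugate_mul, mul_adjugate]

theorem hasFDerivAt_eval_charpoly {n : ℕ} {L : (Fin n → ℝ) → Matrix (Fin n) (Fin n) ℝ}
    {x : Fin n → ℝ} (hL : ∀ i j, DifferentiableAt ℝ (fun y => L y i j) x) (t : ℝ) :
    HasFDerivAt (fun y => (L y).charpoly.eval t)
      (-∑ i, ∑ k, (scalar (Fin n) t - L x).adjugate k i • fderiv ℝ (fun y => L y i k) x) x := by
  simp only [eval_charpoly]
  have h := HasFDerivAt.matrix_det (A := fun y => scalar (Fin n) t - L y)
    (A' := fun i k => -fderiv ℝ (fun y => L y i k) x) (x := x)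
    (fun i k => by
      simpa only [Matrix.sub_apply] using (hL i k).hasFDerivAt.const_sub (scalar (Fin n) t i k))
  simpa only [smul_neg, Finset.sum_neg_distrib] using h

theorem fderiv_eval_charpoly_apply {n : ℕ} {L : (Fin n → ℝ) → Matrix (Fin n) (Fin n) ℝ}
    {x : Fin n → ℝ} (hL : ∀ i j, DifferentiableAt ℝ (fun y => L y i j) x) (t : ℝ)
    (v : Fin n → ℝ) :
    fderiv ℝ (fun y => (L y).charpoly.eval t) x v
      = -((scalar (Fin n) t - L x).adjugate * entryDeriv L x v).trace := by
  rw [(hasFDerivAt_eval_charpoly hL t).fderiv, Matrix.trace_mul_comm]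
  simp [Matrix.trace, Matrix.mul_apply, entryDeriv, mul_comm]

/-- For a Nijenhuis operator, `L^* dχ(t) = t dχ(t) + χ(t) d(tr L)` at every `t`. -/
theorem IsNijenhuis.sum_mul_fderiv_eval_charpoly {n : ℕ}
    {L : (Fin n → ℝ) → Matrix (Fin n) (Fin n) ℝ} (hN : IsNijenhuis L) {x : Fin n → ℝ}
    (hL : ∀ i j, DifferentiableAt ℝ (fun y => L y i j) x) (t : ℝ) (j : Fin n) :
    ∑ s, L x s j * fderiv ℝ (fun y => (L y).charpoly.eval t) x (Pi.single s 1)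
      = t * fderiv ℝ (fun y => (L y).charpoly.eval t) x (Pi.single j 1)
        + (L x).charpoly.eval t * (entryDeriv L x (Pi.single j 1)).trace := by
  obtain ⟨E, hE⟩ := hN.exists_sum_entryDeriv x j
  simp only [fderiv_eval_charpoly_apply hL]
  rw [eval_charpoly]
  set M := scalar (Fin n) t - L x with hM
  set D := entryDeriv L x (Pi.single j 1)
  have hLM : L x = scalar (Fin n) t - M := by rw [hM]; abel
  have hcomm : Commute M.adjugate (L x) := by
    rw [hLM]
    exact ((scalar_commute t (fun r => mul_comm t r) M.adjugate).symm).sub_right M.commute_adjugate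
  have hsum : ∑ s, L x s j * -(M.adjugate * entryDeriv L x (Pi.single s 1)).trace
      = -(M.adjugate * ∑ s, L x s j • entryDeriv L x (Pi.single s 1)).trace := by
    simp [Matrix.mul_sum, trace_sum]
  have hmain : M.adjugate * (L x * D) = t • (M.adjugate * D) - M.det • D := by
    rw [← Matrix.mul_assoc, hLM, mul_sub, adjugate_mul, sub_mul, Matrix.smul_mul, one_mul,
      scalar_apply, ← smul_one_eq_diagonal, Matrix.mul_smul, mul_one, Matrix.smul_mul]
  rw [hsum, hE, mul_add, trace_add, trace_mul_commutator_eq_zero hcomm, hmain, trace_sub,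
    trace_smul, trace_smul, smul_eq_mul, smul_eq_mul]
  ring

theorem eval_charpoly_eq_sum_coeff {n : ℕ} (M : Matrix (Fin n) (Fin n) ℝ) (t : ℝ) :
    M.charpoly.eval t = ∑ k : Fin n, M.charpoly.coeff k * t ^ (k : ℕ) + t ^ n := by
  have hdeg : M.charpoly.natDegree = n := by simp
  have hlead : M.charpoly.coeff n = 1 := by
    simpa [Polynomial.Monic, Polynomial.leadingCoeff] using M.charpoly_monic
  rw [Polynomial.eval_eq_sum_range, hdeg, Finset.sum_range_succ, hlead, one_mul,
    Finset.sum_range]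

/-- For a Nijenhuis operator, the recursion satisfied by the differentials of the coefficients
of the characteristic polynomial. -/
theorem IsNijenhuis.sum_mul_fderiv_coeff_charpoly {n : ℕ}
    {L : (Fin n → ℝ) → Matrix (Fin n) (Fin n) ℝ} (hN : IsNijenhuis L) {x : Fin n → ℝ}
    (hL : ∀ i j, DifferentiableAt ℝ (fun y => L y i j) x)
    (hc : ∀ k : Fin n, DifferentiableAt ℝ (fun y => (L y).charpoly.coeff k) x)
    (k j : Fin n) :
    ∑ s, L x s j * fderiv ℝ (fun y => (L y).charpoly.coeff k) x (Pi.single s 1)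
      = (if (k : ℕ) = 0 then 0
          else fderiv ℝ (fun y => (L y).charpoly.coeff (k - 1)) x (Pi.single j 1))
        + (L x).charpoly.coeff k * (entryDeriv L x (Pi.single j 1)).trace := by
  have hev (t : ℝ) (v : Fin n → ℝ) : fderiv ℝ (fun y => (L y).charpoly.eval t) x v
      = ∑ k : Fin n, fderiv ℝ (fun y => (L y).charpoly.coeff k) x v * t ^ (k : ℕ) := by
    simp only [eval_charpoly_eq_sum_coeff]
    rw [((HasFDerivAt.fun_sum fun k _ =>
      (hc k).hasFDerivAt.mul_const (t ^ (k : ℕ))).add_const (t ^ n)).fderiv]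
    simp [mul_comm]
  let P (v : Fin n → ℝ) : Polynomial ℝ :=
    ∑ k : Fin n, Polynomial.monomial (k : ℕ) (fderiv ℝ (fun y => (L y).charpoly.coeff k) x v)
  have hP (v : Fin n → ℝ) (t : ℝ) :
      (P v).eval t = fderiv ℝ (fun y => (L y).charpoly.eval t) x v := by
    simp [P, hev, Polynomial.eval_finsetSum]
  have hcoeff (v : Fin n → ℝ) (m : ℕ) (hm : m < n) :
      (P v).coeff m = fderiv ℝ (fun y => (L y).charpoly.coeff m) x v := by
    simp only [P, Polynomial.finsetSum_coeff, Polynomial.coeff_monomial]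
    rw [Finset.sum_eq_single ⟨m, hm⟩] <;> simp +contextual [Fin.ext_iff]
  have hpoly : ∑ s, Polynomial.C (L x s j) * P (Pi.single s 1)
      = Polynomial.X * P (Pi.single j 1)
        + (L x).charpoly * Polynomial.C (entryDeriv L x (Pi.single j 1)).trace := by
    refine Polynomial.funext fun t => ?_
    simpa [Polynomial.eval_finsetSum, hP] using hN.sum_mul_fderiv_eval_charpoly hL t j
  have h := congrArg (fun p => p.coeff (k : ℕ)) hpoly
  simp only [Polynomial.finsetSum_coeff, Polynomial.coeff_C_mul, Polynomial.coeff_add,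
    Polynomial.coeff_mul_C, hcoeff _ _ k.2] at h
  rw [h]
  congr 1
  split_ifs with hk
  · simp [hk]
  · obtain ⟨m, hm⟩ := Nat.exists_eq_succ_of_ne_zero hk
    rw [hm, Polynomial.coeff_X_mul, hcoeff _ _ (by omega)]
    rfl

theorem fderiv_charCoeff_zero_apply {n : ℕ} (hn : 0 < n)
    {L : (Fin n → ℝ) → Matrix (Fin n) (Fin n) ℝ} {x : Fin n → ℝ}
    (hL : ∀ i j, DifferentiableAt ℝ (fun y => L y i j) x) (v : Fin n → ℝ) :
    fderiv ℝ (charCoeff L ⟨0, hn⟩) x v = -(entryDeriv L x v).trace := by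
  have : Nonempty (Fin n) := ⟨⟨0, hn⟩⟩
  have h : charCoeff L ⟨0, hn⟩ = fun y => -∑ i, L y i i := by
    funext y
    have := trace_eq_neg_charpoly_coeff (L y)
    simp only [Fintype.card_fin, Matrix.trace, Matrix.diag] at this
    simp [charCoeff, this]
  rw [h, (HasFDerivAt.fun_sum fun i _ => (hL i i).hasFDerivAt).fun_neg.fderiv]
  simp [Matrix.trace, entryDeriv]

/-- The intertwining relation `J L = S_χ J` for a Nijenhuis operator. -/
theorem IsNijenhuis.jacobiMat_mul {n : ℕ}
    {L : (Fin n → ℝ) → Matrix (Fin n) (Fin n) ℝ} (hN : IsNijenhuis L) {x : Fin n → ℝ}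
    (hL : ∀ i j, DifferentiableAt ℝ (fun y => L y i j) x)
    (hc : ∀ i, DifferentiableAt ℝ (charCoeff L i) x) :
    jacobiMat (charCoeff L) x * L x
      = companionS (fun i => charCoeff L i x) * jacobiMat (charCoeff L) x := by
  ext i j
  have hn : 0 < n := i.pos
  have hc' (k : Fin n) : DifferentiableAt ℝ (fun y => (L y).charpoly.coeff k) x := by
    have h := hc k.rev
    have hk : n - 1 - (k.rev : ℕ) = k := by rw [Fin.val_rev]; omega
    unfold charCoeff at h
    simpa only [hk] using h
  have h := hN.sum_mul_fderiv_coeff_charpoly hL hc' i.rev j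
  have hi : (i.rev : ℕ) = n - 1 - i := by rw [Fin.val_rev]; omega
  rw [hi] at h
  have hS (k : Fin n) : companionS (fun i => charCoeff L i x) i k
      = (if k = ⟨0, hn⟩ then -charCoeff L i x else 0)
        + if (k : ℕ) = (i : ℕ) + 1 then 1 else 0 := by
    simp only [companionS, Matrix.of_apply, Fin.ext_iff]
    split_ifs <;> first | omega | simp
  simp only [Matrix.mul_apply, hS, add_mul, Finset.sum_add_distrib, ite_mul, zero_mul, one_mul,
    Finset.sum_ite_eq', Finset.mem_univ, if_true]
  simp only [jacobiMat, Matrix.of_apply, fderiv_charCoeff_zero_apply hn hL]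
  rw [neg_mul_neg, add_comm]
  simp only [mul_comm _ (L x _ j)]
  refine h.trans ?_
  congr 1
  by_cases hlast : n - 1 - (i : ℕ) = 0
  · rw [if_pos hlast, Finset.sum_eq_zero]
    intro k _
    rw [if_neg (by omega)]
  · rw [if_neg hlast, Finset.sum_eq_single ⟨i + 1, by omega⟩]
    · have hk : n - 1 - (i : ℕ) - 1 = n - 1 - (i + 1) := by omega
      rw [if_pos rfl, hk]
      rfl
    · intro k _ hk
      rw [if_neg fun h => hk (Fin.ext h)]
    · simp

theorem isUnit_jacobiMat {n : ℕ} {σ : Fin n → (Fin n → ℝ) → ℝ} {x : Fin n → ℝ}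
    (hind : LinearIndependent ℝ fun i => fderiv ℝ (σ i) x) : IsUnit (jacobiMat σ x) := by
  rw [← Matrix.linearIndependent_rows_iff_isUnit]
  rw [Fintype.linearIndependent_iff] at hind ⊢
  intro g hg
  refine hind g ?_
  refine ContinuousLinearMap.coe_injective (LinearMap.pi_ext' fun j => LinearMap.ext_ring ?_)
  simpa [jacobiMat, Matrix.row] using congrFun hg j

/-- If at a point `x` the differentials of the coefficients of the characteristic
polynomial of a smooth Nijenhuis operator `L` are linearly independent, then
`L(x) = J(x)⁻¹ S_χ(x) J(x)`. -/
theorem stmt2 (n : ℕ) (L : (Fin n → ℝ) → Matrix (Fin n) (Fin n) ℝ)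
    (hsmooth : ∀ i j : Fin n, ContDiff ℝ (⊤ : ℕ∞) fun x => L x i j)
    (hN : IsNijenhuis L) (x : Fin n → ℝ)
    (hind : LinearIndependent ℝ (fun i : Fin n => fderiv ℝ (charCoeff L i) x)) :
    L x = (jacobiMat (charCoeff L) x)⁻¹
        * companionS (fun i => charCoeff L i x) * jacobiMat (charCoeff L) x := by
  have hL (i j : Fin n) : DifferentiableAt ℝ (fun y => L y i j) x :=
    (hsmooth i j).contDiffAt.differentiableAt (by simp)
  have hc (i : Fin n) : DifferentiableAt ℝ (charCoeff L i) x :=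
    not_imp_comm.1 fderiv_zero_of_not_differentiableAt (hind.ne_zero i)
  rw [Matrix.mul_assoc, ← hN.jacobiMat_mul hL hc, Matrix.nonsing_inv_mul_cancel_left _ _
    ((Matrix.isUnit_iff_isUnit_det _).1 (isUnit_jacobiMat hind))]
end

section
/- Every 2-dimensional differentially non-degenerate left-symmetric algebra over ℝ is isomorphic (as an algebra) to exactly one of the following four algebras with basis η₁, η₂ and unlisted products zero: 𝔟₄⁺: η₁⋆η₁ = 2η₁, η₁⋆η₂ = η₂, η₂⋆η₂ = −η₁; 𝔟₄⁻: η₁⋆η₁ = 2η₁, η₁⋆η₂ = η₂, η₂⋆η₂ = η₁; 𝔠₅⁺: η₁⋆η₁ = η₁, η₁⋆η₂ = η₂, η₂⋆η₁ = η₂, η₂⋆η₂ = η₁; 𝔠₅⁻: η₁⋆η₁ = η₁, η₁⋆η₂ = η₂, η₂⋆η₁ = η₂, η₂⋆η₂ = −η₁. Each of these four algebras is a differentially non-degenerate LSA. -/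
open Matrix

/-- Structure constants of `𝔟₄⁺`: `η₁⋆η₁ = 2η₁`, `η₁⋆η₂ = η₂`, `η₂⋆η₂ = -η₁`. -/
def b4p : Fin 2 → Fin 2 → Fin 2 → ℝ :=
  ![![![2, 0], ![0, 1]], ![![0, 0], ![-1, 0]]]

/-- Structure constants of `𝔟₄⁻`: `η₁⋆η₁ = 2η₁`, `η₁⋆η₂ = η₂`, `η₂⋆η₂ = η₁`. -/
def b4m : Fin 2 → Fin 2 → Fin 2 → ℝ :=
  ![![![2, 0], ![0, 1]], ![![0, 0], ![1, 0]]]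

/-- Structure constants of `𝔠₅⁺`: `η₁⋆η₁ = η₁`, `η₁⋆η₂ = η₂`, `η₂⋆η₁ = η₂`,
`η₂⋆η₂ = η₁`. -/
def c5p : Fin 2 → Fin 2 → Fin 2 → ℝ :=
  ![![![1, 0], ![0, 1]], ![![0, 1], ![1, 0]]]

/-- Structure constants of `𝔠₅⁻`: `η₁⋆η₁ = η₁`, `η₁⋆η₂ = η₂`, `η₂⋆η₁ = η₂`,
`η₂⋆η₂ = -η₁`. -/
def c5m : Fin 2 → Fin 2 → Fin 2 → ℝ :=
  ![![![1, 0], ![0, 1]], ![![0, 1], ![-1, 0]]]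

/-- The four 2-dimensional model algebras. -/
def models2 : Fin 4 → (Fin 2 → Fin 2 → Fin 2 → ℝ) := ![b4p, b4m, c5p, c5m]

open MvPolynomial in
/-- A family of functions taking all values in a product of infinite sets is algebraically
independent. -/
theorem algebraicIndependent_of_forall_exists {X ι : Type*} (f : ι → X → ℝ) (S : ι → Set ℝ)
    (hS : ∀ i, (S i).Infinite)
    (h : ∀ s ∈ Set.pi Set.univ S, ∃ x, ∀ i, f i x = s i) : AlgebraicIndependent ℝ f := by
  rw [algebraicIndependent_iff]
  intro p hp
  refine MvPolynomial.funext_set S hS fun s hs => ?_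
  obtain ⟨x, hx⟩ := h s hs
  have hpx : aeval (fun i => f i x) p = 0 := by
    have := congrArg (Pi.evalAlgHom ℝ (fun _ : X => ℝ) x) hp
    rwa [← AlgHom.comp_apply, comp_aeval] at this
  rw [funext hx] at hpx
  simpa [aeval_eq_eval] using hpx

theorem charCoeff_zero_fin_two (L : (Fin 2 → ℝ) → Matrix (Fin 2) (Fin 2) ℝ) (x : Fin 2 → ℝ) :
    charCoeff L 0 x = -(L x).trace := by
  simp [charCoeff, Matrix.charpoly_fin_two, Polynomial.coeff_C]

theorem charCoeff_one_fin_two (L : (Fin 2 → ℝ) → Matrix (Fin 2) (Fin 2) ℝ) (x : Fin 2 → ℝ) :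
    charCoeff L 1 x = (L x).det := by
  simp [charCoeff, Matrix.charpoly_fin_two]

open MvPolynomial in
theorem DiffNonDeg.exists_trace_ne_zero {a : Fin 2 → Fin 2 → Fin 2 → ℝ} (h : DiffNonDeg a) :
    ∃ x, (rightAdj a x).trace ≠ 0 := by
  by_contra! H
  have h0 : (X 0 : MvPolynomial (Fin 2) ℝ) = 0 := by
    refine (algebraicIndependent_iff.mp h) _ ?_
    ext x
    simp [charCoeff_zero_fin_two, H x]
  exact X_ne_zero _ h0

open MvPolynomial in
theorem DiffNonDeg.exists_det_ne {a : Fin 2 → Fin 2 → Fin 2 → ℝ} (h : DiffNonDeg a) (c : ℝ) :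
    ∃ x, (rightAdj a x).det ≠ c * (rightAdj a x).trace ^ 2 := by
  by_contra! H
  have h0 : (X 1 - C c * X 0 ^ 2 : MvPolynomial (Fin 2) ℝ) = 0 := by
    refine (algebraicIndependent_iff.mp h) _ ?_
    ext x
    simp [charCoeff_zero_fin_two, charCoeff_one_fin_two, H x]
  simpa using congrArg (eval ![0, 1]) h0

theorem rightAdj_mulVec {n : ℕ} (a : Fin n → Fin n → Fin n → ℝ) (x ξ : Fin n → ℝ) :
    rightAdj a x *ᵥ ξ = mulSC a ξ x := by
  ext k
  simp only [Matrix.mulVec, dotProduct, rightAdj, mulSC, Matrix.of_apply, Finset.sum_mul]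
  exact Finset.sum_congr rfl fun i _ => Finset.sum_congr rfl fun j _ => by ring

theorem toLin'_rightAdj_conj {n : ℕ} {a b : Fin n → Fin n → Fin n → ℝ}
    (φ : (Fin n → ℝ) ≃ₗ[ℝ] (Fin n → ℝ))
    (hφ : ∀ ξ η : Fin n → ℝ, φ (mulSC a ξ η) = mulSC b (φ ξ) (φ η)) (x : Fin n → ℝ) :
    Matrix.toLin' (rightAdj b (φ x)) = φ.conj (Matrix.toLin' (rightAdj a x)) := by
  refine LinearMap.ext fun ξ => ?_
  simp [LinearEquiv.conj_apply, rightAdj_mulVec, hφ]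

theorem trace_rightAdj_map {n : ℕ} {a b : Fin n → Fin n → Fin n → ℝ}
    (φ : (Fin n → ℝ) ≃ₗ[ℝ] (Fin n → ℝ))
    (hφ : ∀ ξ η : Fin n → ℝ, φ (mulSC a ξ η) = mulSC b (φ ξ) (φ η)) (x : Fin n → ℝ) :
    (rightAdj b (φ x)).trace = (rightAdj a x).trace := by
  rw [← Matrix.trace_toLin'_eq, ← Matrix.trace_toLin'_eq, toLin'_rightAdj_conj φ hφ,
    LinearMap.trace_conj']

theorem det_rightAdj_map {n : ℕ} {a b : Fin n → Fin n → Fin n → ℝ}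
    (φ : (Fin n → ℝ) ≃ₗ[ℝ] (Fin n → ℝ))
    (hφ : ∀ ξ η : Fin n → ℝ, φ (mulSC a ξ η) = mulSC b (φ ξ) (φ η)) (x : Fin n → ℝ) :
    (rightAdj b (φ x)).det = (rightAdj a x).det := by
  rw [← LinearMap.det_toLin', ← LinearMap.det_toLin', toLin'_rightAdj_conj φ hφ,
    LinearEquiv.conj_apply, LinearMap.comp_assoc]
  exact LinearMap.det_conj _ φ

theorem AlgIsoSC.symm {n : ℕ} {a b : Fin n → Fin n → Fin n → ℝ} (h : AlgIsoSC a b) :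
    AlgIsoSC b a := by
  obtain ⟨φ, hφ⟩ := h
  exact ⟨φ.symm, fun ξ η => φ.injective (by simp [hφ])⟩

theorem AlgIsoSC.trans {n : ℕ} {a b c : Fin n → Fin n → Fin n → ℝ} (h : AlgIsoSC a b)
    (h' : AlgIsoSC b c) : AlgIsoSC a c := by
  obtain ⟨φ, hφ⟩ := h
  obtain ⟨ψ, hψ⟩ := h'
  exact ⟨φ.trans ψ, fun ξ η => by simp [hφ, hψ]⟩

theorem IsLSA.of_map {n : ℕ} {a b : Fin n → Fin n → Fin n → ℝ} (ha : IsLSA a)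
    (φ : (Fin n → ℝ) ≃ₗ[ℝ] (Fin n → ℝ))
    (hφ : ∀ ξ η : Fin n → ℝ, φ (mulSC a ξ η) = mulSC b (φ ξ) (φ η)) : IsLSA b := by
  intro ξ η ζ
  obtain ⟨ξ, rfl⟩ := φ.surjective ξ
  obtain ⟨η, rfl⟩ := φ.surjective η
  obtain ⟨ζ, rfl⟩ := φ.surjective ζ
  simp only [← hφ, ← map_sub, ha ξ η ζ]

/-- Structure constants of the algebra transported along a linear equivalence. -/
def transportSC {n : ℕ} (a : Fin n → Fin n → Fin n → ℝ) (φ : (Fin n → ℝ) ≃ₗ[ℝ] (Fin n → ℝ)) :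
    Fin n → Fin n → Fin n → ℝ :=
  fun i j => φ (mulSC a (φ.symm (Pi.single i 1)) (φ.symm (Pi.single j 1)))

theorem mulSC_eq_sum {n : ℕ} (a : Fin n → Fin n → Fin n → ℝ) (ξ η : Fin n → ℝ) :
    mulSC a ξ η = ∑ i, ∑ j, (ξ i * η j) • a i j := by
  ext k
  simp only [mulSC, Finset.sum_apply, Pi.smul_apply, smul_eq_mul]
  exact Finset.sum_congr rfl fun i _ => Finset.sum_congr rfl fun j _ => by ring

/-- The product `mulSC a` as a bilinear map. -/
def mulSCBilin {n : ℕ} (a : Fin n → Fin n → Fin n → ℝ) :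
    (Fin n → ℝ) →ₗ[ℝ] (Fin n → ℝ) →ₗ[ℝ] (Fin n → ℝ) :=
  LinearMap.mk₂ ℝ (mulSC a)
    (fun _ _ _ => by simp only [mulSC_eq_sum, Pi.add_apply, add_mul, add_smul,
      Finset.sum_add_distrib])
    (fun _ _ _ => by simp only [mulSC_eq_sum, Pi.smul_apply, smul_eq_mul, mul_assoc, mul_smul,
      Finset.smul_sum])
    (fun _ _ _ => by simp only [mulSC_eq_sum, Pi.add_apply, mul_add, add_smul,
      Finset.sum_add_distrib])
    (fun _ _ _ => by simp only [mulSC_eq_sum, Pi.smul_apply, smul_eq_mul, mul_left_comm _ _ _,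
      mul_smul, Finset.smul_sum])

theorem map_mulSC_transportSC {n : ℕ} (a : Fin n → Fin n → Fin n → ℝ)
    (φ : (Fin n → ℝ) ≃ₗ[ℝ] (Fin n → ℝ)) (ξ η : Fin n → ℝ) :
    φ (mulSC a ξ η) = mulSC (transportSC a φ) (φ ξ) (φ η) := by
  have key : (mulSCBilin a).compl₁₂ φ.symm.toLinearMap φ.symm.toLinearMap
      = (mulSCBilin (transportSC a φ)).compr₂ φ.symm.toLinearMap := by
    refine LinearMap.pi_ext' fun i => LinearMap.ext_ring ?_
    refine LinearMap.pi_ext' fun j => LinearMap.ext_ring ?_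
    apply φ.injective
    simp [mulSCBilin, mulSC_eq_sum (transportSC a φ), Pi.single_apply, transportSC]
  have h := congrArg φ (LinearMap.congr_fun₂ key (φ ξ) (φ η))
  simpa [mulSCBilin] using h

theorem exists_linearEquiv_fin_two (p q r s : ℝ) (h : p * s - q * r ≠ 0) :
    ∃ φ : (Fin 2 → ℝ) ≃ₗ[ℝ] (Fin 2 → ℝ),
      ∀ x, φ x = ![p * x 0 + q * x 1, r * x 0 + s * x 1] := by
  let M : Matrix (Fin 2) (Fin 2) ℝ := !![p, q; r, s]
  have hM : IsUnit M.det := by simpa [M, Matrix.det_fin_two] using h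
  let := M.invertibleOfIsUnitDet hM
  refine ⟨M.toLinearEquiv' this, fun x => ?_⟩
  ext i
  fin_cases i <;> simp [M, Matrix.mulVec, dotProduct, Matrix.toLinearEquiv']

theorem trace_rightAdj_fin_two (a : Fin 2 → Fin 2 → Fin 2 → ℝ) (x : Fin 2 → ℝ) :
    (rightAdj a x).trace = (a 0 0 0 + a 1 0 1) * x 0 + (a 0 1 0 + a 1 1 1) * x 1 := by
  simp [Matrix.trace_fin_two, rightAdj]
  ring

theorem det_rightAdj_fin_two (a : Fin 2 → Fin 2 → Fin 2 → ℝ) (x : Fin 2 → ℝ) :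
    (rightAdj a x).det = (a 0 0 0 * x 0 + a 0 1 0 * x 1) * (a 1 0 1 * x 0 + a 1 1 1 * x 1)
      - (a 1 0 0 * x 0 + a 1 1 0 * x 1) * (a 0 0 1 * x 0 + a 0 1 1 * x 1) := by
  simp [Matrix.det_fin_two, rightAdj]

/-- In a left-symmetric algebra `tr R(ξ ⋆ η) = tr (R(η) R(ξ))`, since
`R(ξ ⋆ η) - R(η) R(ξ)` is a commutator. -/
theorem IsLSA.trace_rightAdj_mulSC {a : Fin 2 → Fin 2 → Fin 2 → ℝ} (ha : IsLSA a)
    (ξ η : Fin 2 → ℝ) :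
    (rightAdj a (mulSC a ξ η)).trace = (rightAdj a η * rightAdj a ξ).trace := by
  have h0 := congrFun (ha ξ ![1, 0] η) 0
  have h1 := congrFun (ha ξ ![0, 1] η) 1
  simp [mulSC, rightAdj, Matrix.trace_fin_two, Matrix.mul_apply] at h0 h1 ⊢
  linear_combination h0 + h1

theorem exists_algIsoSC_trace_normalized {a : Fin 2 → Fin 2 → Fin 2 → ℝ} (ha : IsLSA a)
    (hd : DiffNonDeg a) :
    ∃ b : Fin 2 → Fin 2 → Fin 2 → ℝ, AlgIsoSC a b ∧ IsLSA b ∧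
      (∀ x, (rightAdj b x).trace = 2 * x 0) ∧
      ∀ c, ∃ x, (rightAdj b x).det ≠ c * (rightAdj b x).trace ^ 2 := by
  set α := a 0 0 0 + a 1 0 1 with hα
  set β := a 0 1 0 + a 1 1 1 with hβ
  have hne : α ^ 2 + β ^ 2 ≠ 0 := by
    intro h
    obtain ⟨x, hx⟩ := hd.exists_trace_ne_zero
    have h1 : α = 0 := by nlinarith [sq_nonneg α, sq_nonneg β]
    have h2 : β = 0 := by nlinarith [sq_nonneg α, sq_nonneg β]
    rw [trace_rightAdj_fin_two, ← hα, ← hβ, h1, h2] at hx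
    simp at hx
  obtain ⟨φ, hφ⟩ := exists_linearEquiv_fin_two (α / 2) (β / 2) (-β) α (by
    contrapose! hne
    linear_combination 2 * hne)
  have hmap := map_mulSC_transportSC a φ
  refine ⟨transportSC a φ, ⟨φ, hmap⟩, ha.of_map φ hmap, fun x => ?_, fun c => ?_⟩
  · obtain ⟨x, rfl⟩ := φ.surjective x
    rw [trace_rightAdj_map φ hmap, trace_rightAdj_fin_two, hφ]
    simp
    ring
  · obtain ⟨x, hx⟩ := hd.exists_det_ne c
    exact ⟨φ x, by rwa [trace_rightAdj_map φ hmap, det_rightAdj_map φ hmap]⟩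

/-- The two-parameter normal form containing all four models: `η₁⋆η₁ = (1 + s) η₁`,
`η₁⋆η₂ = η₂`, `η₂⋆η₁ = (1 - s) η₂`, `η₂⋆η₂ = ε η₁`. -/
def normalForm2 (s ε : ℝ) : Fin 2 → Fin 2 → Fin 2 → ℝ :=
  ![![![1 + s, 0], ![0, 1]], ![![0, 1 - s], ![ε, 0]]]

theorem exists_algIsoSC_normalForm2 {b : Fin 2 → Fin 2 → Fin 2 → ℝ} (hb : IsLSA b)
    (ht : ∀ x, (rightAdj b x).trace = 2 * x 0)
    (hd : ∀ c, ∃ x, (rightAdj b x).det ≠ c * (rightAdj b x).trace ^ 2) :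
    ∃ s ε : ℝ, (s = 0 ∨ s = 1) ∧ (ε = 1 ∨ ε = -1) ∧ AlgIsoSC b (normalForm2 s ε) := by
  have e00 := hb.trace_rightAdj_mulSC ![1, 0] ![1, 0]
  have e01 := hb.trace_rightAdj_mulSC ![1, 0] ![0, 1]
  have e10 := hb.trace_rightAdj_mulSC ![0, 1] ![1, 0]
  have e11 := hb.trace_rightAdj_mulSC ![0, 1] ![0, 1]
  have t0 := ht ![1, 0]
  have t1 := ht ![0, 1]
  rw [ht] at e00 e01 e10 e11
  rw [trace_rightAdj_fin_two] at t0 t1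
  simp only [det_rightAdj_fin_two, ht] at hd
  simp [mulSC, rightAdj, Matrix.trace_fin_two, Matrix.mul_apply] at e00 e01 e10 e11 t0 t1
  obtain ⟨s, hs⟩ : ∃ s, b 0 0 0 = 1 + s := ⟨b 0 0 0 - 1, by ring⟩
  obtain ⟨g, hg⟩ : ∃ g, b 1 1 0 = g := ⟨_, rfl⟩
  obtain ⟨p, hp⟩ : ∃ p, b 0 1 0 = p := ⟨_, rfl⟩
  obtain ⟨m, hm⟩ : ∃ m, b 0 0 1 = m := ⟨_, rfl⟩
  obtain ⟨n, hn⟩ : ∃ n, b 0 1 1 = n := ⟨_, rfl⟩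
  have h100 : b 1 0 0 = p := by linarith
  have h101 : b 1 0 1 = 1 - s := by linarith
  have h111 : b 1 1 1 = -p := by linarith
  simp only [hs, hg, hp, hm, hn, h100, h101, h111] at e00 e01 e11 hd
  have hg0 : g ≠ 0 := by
    rintro rfl
    have hp0 : p = 0 := by
      have : p ^ 2 = 0 := by linarith
      simpa using this
    obtain ⟨x, hx⟩ := hd ((1 - s ^ 2) / 4)
    apply hx
    rw [hp0]
    ring
  obtain ⟨k, rfl⟩ : ∃ k, p = -(g * k) := ⟨-p / g, by field_simp⟩
  obtain rfl : n = 1 - g * k ^ 2 := mul_left_cancel₀ hg0 (by linear_combination -e11 / 2)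
  obtain ⟨s, rfl⟩ : ∃ s', s = s' + g * k ^ 2 := ⟨s - g * k ^ 2, by ring⟩
  obtain rfl : m = -k * (1 - 2 * s - g * k ^ 2) :=
    mul_left_cancel₀ hg0 (by linear_combination -e01)
  have hs01 : s = 0 ∨ s = 1 := by
    have : s * (s - 1) = 0 := by linear_combination -e00 / 2
    rcases mul_eq_zero.mp this with h | h
    · exact Or.inl h
    · exact Or.inr (by linarith)
  obtain ⟨ε, q, hε, hq, hgq⟩ : ∃ ε q : ℝ, (ε = 1 ∨ ε = -1) ∧ q ≠ 0 ∧ g = ε * q ^ 2 := by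
    rcases lt_or_gt_of_ne hg0 with h | h
    · exact ⟨-1, √(-g), Or.inr rfl, (Real.sqrt_pos.mpr (by linarith)).ne', by
        rw [Real.sq_sqrt (by linarith)]; ring⟩
    · exact ⟨1, √g, Or.inl rfl, (Real.sqrt_pos.mpr h).ne', by
        rw [Real.sq_sqrt h.le]; ring⟩
  obtain ⟨φ, hφ⟩ := exists_linearEquiv_fin_two 1 0 (-(q * k)) q (by simpa using hq)
  refine ⟨s, ε, hs01, hε, φ, fun ξ η => ?_⟩
  subst hgq
  rw [hφ, hφ, hφ]
  ext i
  fin_cases i <;>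
  · simp [mulSC, normalForm2, hs, hg, hp, hm, hn, h100, h101, h111]
    ring

theorem eq_of_algIsoSC_models2 {m m' : Fin 4} (h : AlgIsoSC (models2 m) (models2 m')) :
    m = m' := by
  obtain ⟨φ, hφ⟩ := h
  have ht := trace_rightAdj_map φ hφ
  have hd := det_rightAdj_map φ hφ
  have t0 := ht ![1, 0]
  have t1 := ht ![0, 1]
  have d0 := hd ![1, 0]
  have d1 := hd ![0, 1]
  have d2 := hd ![1, 1]
  have hadd : φ ![1, 1] = φ ![1, 0] + φ ![0, 1] := by rw [← map_add]; simp
  rw [hadd] at d2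
  generalize φ ![1, 0] = u at *
  generalize φ ![0, 1] = v at *
  simp only [trace_rightAdj_fin_two, det_rightAdj_fin_two] at t0 t1 d0 d1 d2
  fin_cases m <;> fin_cases m' <;> first
  | rfl
  | exfalso
    simp [models2, b4p, b4m, c5p, c5m] at t0 t1 d0 d1 d2
    have hu : u 0 = 1 := by linarith
    have hv : v 0 = 0 := by linarith
    try simp only [hu, hv] at d0 d1 d2
    nlinarith [sq_nonneg (v 1), sq_nonneg (u 1)]

theorem isLSA_models2 (m : Fin 4) : IsLSA (models2 m) := by
  intro ξ η ζ
  ext k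
  fin_cases m <;> fin_cases k <;>
  · simp [models2, mulSC, b4p, b4m, c5p, c5m]
    ring

theorem diffNonDeg_of_forall_exists {a : Fin 2 → Fin 2 → Fin 2 → ℝ} {T : Set ℝ}
    (hT : T.Infinite)
    (h : ∀ s ∈ Set.Icc (0 : ℝ) 1, ∀ u ∈ T, ∃ x,
      (rightAdj a x).trace = -s ∧ (rightAdj a x).det = u) :
    DiffNonDeg a := by
  refine algebraicIndependent_of_forall_exists _ ![Set.Icc 0 1, T] ?_ ?_
  · simp [Fin.forall_fin_two, hT, Set.Icc_infinite]
  · intro s hs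
    obtain ⟨x, hx0, hx1⟩ := h (s 0) (hs 0 trivial) (s 1) (hs 1 trivial)
    refine ⟨x, Fin.forall_fin_two.mpr ⟨?_, ?_⟩⟩
    · rw [charCoeff_zero_fin_two, hx0, neg_neg]
    · rw [charCoeff_one_fin_two, hx1]

theorem diffNonDeg_models2 (m : Fin 4) : DiffNonDeg (models2 m) := by
  fin_cases m
  · refine diffNonDeg_of_forall_exists (Set.Ici_infinite 0) fun s _ u hu =>
      ⟨![-s / 2, √u], ?_⟩
    have := Real.sq_sqrt (x := u) hu
    simp [trace_rightAdj_fin_two, det_rightAdj_fin_two, models2, b4p]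
    constructor <;> linarith
  · refine diffNonDeg_of_forall_exists (Set.Iic_infinite 0) fun s _ u hu =>
      ⟨![-s / 2, √(-u)], ?_⟩
    have := Real.sq_sqrt (x := -u) (by simpa using hu)
    simp [trace_rightAdj_fin_two, det_rightAdj_fin_two, models2, b4m]
    constructor <;> linarith
  · refine diffNonDeg_of_forall_exists (Set.Iic_infinite 0) fun s _ u hu =>
      ⟨![-s / 2, √(s ^ 2 / 4 - u)], ?_⟩
    have := Real.sq_sqrt (x := s ^ 2 / 4 - u) (by
      have : u ≤ 0 := hu
      nlinarith [sq_nonneg s])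
    simp [trace_rightAdj_fin_two, det_rightAdj_fin_two, models2, c5p]
    constructor <;> linarith
  · refine diffNonDeg_of_forall_exists (Set.Ici_infinite 1) fun s hs u hu =>
      ⟨![-s / 2, √(u - s ^ 2 / 4)], ?_⟩
    have := Real.sq_sqrt (x := u - s ^ 2 / 4) (by
      have : 1 ≤ u := hu
      nlinarith [hs.1, hs.2])
    simp [trace_rightAdj_fin_two, det_rightAdj_fin_two, models2, c5m]
    constructor <;> linarith

theorem exists_models2_eq_normalForm2 {s ε : ℝ} (hs : s = 0 ∨ s = 1) (hε : ε = 1 ∨ ε = -1) :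
    ∃ m, models2 m = normalForm2 s ε := by
  rcases hs with rfl | rfl <;> rcases hε with rfl | rfl
  · exact ⟨2, by simp [models2, c5p, normalForm2]⟩
  · exact ⟨3, by simp [models2, c5m, normalForm2]⟩
  · exact ⟨1, by norm_num [models2, b4m, normalForm2]⟩
  · exact ⟨0, by norm_num [models2, b4p, normalForm2]⟩

/-- Classification of 2-dimensional differentially non-degenerate LSAs: every such
algebra is isomorphic to exactly one of `𝔟₄⁺, 𝔟₄⁻, 𝔠₅⁺, 𝔠₅⁻`, and each of these four
is a differentially non-degenerate LSA. -/
theorem stmt6 :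
    (∀ a : Fin 2 → Fin 2 → Fin 2 → ℝ, IsLSA a → DiffNonDeg a →
      ∃! m : Fin 4, AlgIsoSC a (models2 m)) ∧
    (∀ m : Fin 4, IsLSA (models2 m) ∧ DiffNonDeg (models2 m)) := by
  refine ⟨fun a ha hd => ?_, fun m => ⟨isLSA_models2 m, diffNonDeg_models2 m⟩⟩
  obtain ⟨b, hab, hb, ht, hdet⟩ := exists_algIsoSC_trace_normalized ha hd
  obtain ⟨s, ε, hs, hε, hbn⟩ := exists_algIsoSC_normalForm2 hb ht hdet
  obtain ⟨m, hm⟩ := exists_models2_eq_normalForm2 hs hε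
  rw [← hm] at hbn
  exact ⟨m, hab.trans hbn, fun m' hm' => eq_of_algIsoSC_models2 (hm'.symm.trans (hab.trans hbn))⟩
end
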